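/- Let Ω ⊆ ℝⁿ, n ≥ 2, be open and bounded, and let u ∈ Λ_n^0(Ω), where Λ_2^0(Ω) = L_{exp,0}(Ω) when n = 2 and Λ_n^0(Ω) = L_0^{n/(n−2),∞}(Ω) when n ≥ 3. Then there exist a function v ∈ W^{2,1}_{Δ,0}(Ω) and a constant C ≥ 0 such that u*(t) ≤ v*(t) + C for all t with 0 < t ≤ |Ω|. -/

import Mathlib

open MeasureTheory Filter Topology
open scoped ENNReal

noncomputable section

/-- Euclidean space ℝⁿ. -/
abbrev Euc (n : ℕ) := EuclideanSpace ℝ (Fin n)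

/-- The (pointwise) Laplacian of a function on ℝⁿ: the trace of the second derivative. -/
def lapl (n : ℕ) (φ : Euc n → ℝ) (x : Euc n) : ℝ :=
  ∑ i : Fin n,
    iteratedFDeriv ℝ 2 φ x ![EuclideanSpace.single i (1 : ℝ), EuclideanSpace.single i (1 : ℝ)]

/-- A test function on Ω: smooth and compactly supported inside Ω. -/
def IsTestFun (n : ℕ) (Ω : Set (Euc n)) (φ : Euc n → ℝ) : Prop :=
  ContDiff ℝ (⊤ : ℕ∞) φ ∧ HasCompactSupport φ ∧ tsupport φ ⊆ Ω

/-- `u ∈ W₀^{1,1}(Ω)`: `u` is an L¹(Ω) limit of test functions whose gradients converge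
in L¹(Ω) (i.e. `u` is in the closure of C_c^∞(Ω) in the W^{1,1} norm). -/
def MemW0_1_1 (n : ℕ) (Ω : Set (Euc n)) (u : Euc n → ℝ) : Prop :=
  IntegrableOn u Ω volume ∧
  ∃ φ : ℕ → Euc n → ℝ, (∀ k, IsTestFun n Ω (φ k)) ∧
    Tendsto (fun k => ∫ x in Ω, |φ k x - u x|) atTop (𝓝 0) ∧
    ∃ g : Euc n → Euc n →L[ℝ] ℝ,
      IntegrableOn (fun x => ‖g x‖) Ω volume ∧
      Tendsto (fun k => ∫ x in Ω, ‖fderiv ℝ (φ k) x - g x‖) atTop (𝓝 0)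

/-- `u ∈ W^{2,1}_Δ(Ω)` with distributional Laplacian `f ∈ L¹(Ω)`. -/
def MemW21Delta (n : ℕ) (Ω : Set (Euc n)) (u f : Euc n → ℝ) : Prop :=
  MemW0_1_1 n Ω u ∧ IntegrableOn f Ω volume ∧
    ∀ ψ : Euc n → ℝ, IsTestFun n Ω ψ →
      ∫ x in Ω, u x * lapl n ψ x = ∫ x in Ω, f x * ψ x

/-- `u ∈ W^{2,1}_{Δ,0}(Ω)` with Laplacian `f`: `u` is an L¹(Ω) limit of test functions `φ k`
with `Δ(φ k) → f` in L¹(Ω) (closure of C_c^∞(Ω) in the norm ‖Δu‖₁). -/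
def MemW21Delta0 (n : ℕ) (Ω : Set (Euc n)) (u f : Euc n → ℝ) : Prop :=
  IntegrableOn u Ω volume ∧ IntegrableOn f Ω volume ∧
  ∃ φ : ℕ → Euc n → ℝ, (∀ k, IsTestFun n Ω (φ k)) ∧
    Tendsto (fun k => ∫ x in Ω, |φ k x - u x|) atTop (𝓝 0) ∧
    Tendsto (fun k => ∫ x in Ω, |lapl n (φ k) x - f x|) atTop (𝓝 0)

/-- The decreasing rearrangement `u*(t)` of `u` on Ω. -/
def decRearr (n : ℕ) (Ω : Set (Euc n)) (u : Euc n → ℝ) (t : ℝ) : ℝ :=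
  sInf {s : ℝ | 0 ≤ s ∧ volume {x ∈ Ω | s < |u x|} ≤ ENNReal.ofReal t}

/-- `‖f‖_{L¹(Ω)}`. -/
def L1norm (n : ℕ) (Ω : Set (Euc n)) (f : Euc n → ℝ) : ℝ := ∫ x in Ω, |f x|

/-- ω_{n-1}: surface measure of the unit sphere in ℝⁿ. -/
def omegaS (n : ℕ) : ℝ := 2 * Real.pi ^ ((n : ℝ) / 2) / Real.Gamma ((n : ℝ) / 2)

/-- c_n = 1/((n-2) ω_{n-1}). -/
def cConst (n : ℕ) : ℝ := 1 / (((n : ℝ) - 2) * omegaS n)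

/-- `N*_V(t)`: the rearrangement of the Green function of the ball of volume V. -/
def NstarV (n : ℕ) (V t : ℝ) : ℝ :=
  if n = 2 then (1 / (4 * Real.pi)) * Real.log (V / t)
  else cConst n * (omegaS n / (n : ℝ)) ^ (((n : ℝ) - 2) / (n : ℝ)) *
    (t ^ (-(((n : ℝ) - 2) / (n : ℝ))) - V ^ (-(((n : ℝ) - 2) / (n : ℝ))))

/-- `N*_∞(t)` (for n ≥ 3). -/
def NstarInf (n : ℕ) (t : ℝ) : ℝ :=
  cConst n * (omegaS n / (n : ℝ)) ^ (((n : ℝ) - 2) / (n : ℝ)) *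
    t ^ (-(((n : ℝ) - 2) / (n : ℝ)))

/-- The maximal function `u**(t) = (1/t) ∫₀ᵗ u*(s) ds`. -/
def maximalFn (n : ℕ) (Ω : Set (Euc n)) (u : Euc n → ℝ) (t : ℝ) : ℝ :=
  (1 / t) * ∫ s in (0:ℝ)..t, decRearr n Ω u s

/-- `u ∈ L_exp(Ω)`. -/
def MemLexp (n : ℕ) (Ω : Set (Euc n)) (u : Euc n → ℝ) : Prop :=
  ∃ M : ℝ, ∀ t : ℝ, 0 < t → t ≤ (volume Ω).toReal →
    decRearr n Ω u t / (1 + Real.log ((volume Ω).toReal / t)) ≤ M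

/-- `u ∈ L_{exp,0}(Ω)`. -/
def MemLexp0 (n : ℕ) (Ω : Set (Euc n)) (u : Euc n → ℝ) : Prop :=
  MemLexp n Ω u ∧
    Tendsto (fun t : ℝ => maximalFn n Ω u t / Real.log (1 / t)) (𝓝[>] 0) (𝓝 0)

/-- `u ∈ L^{n/(n-2),∞}(Ω)`. -/
def MemWeakL (n : ℕ) (Ω : Set (Euc n)) (u : Euc n → ℝ) : Prop :=
  ∃ M : ℝ, ∀ t : ℝ, 0 < t → t ≤ (volume Ω).toReal →
    t ^ (((n : ℝ) - 2) / (n : ℝ)) * decRearr n Ω u t ≤ M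

/-- `u ∈ L₀^{n/(n-2),∞}(Ω)`. -/
def MemWeakL0 (n : ℕ) (Ω : Set (Euc n)) (u : Euc n → ℝ) : Prop :=
  MemWeakL n Ω u ∧
    Tendsto (fun t : ℝ => t ^ (((n : ℝ) - 2) / (n : ℝ)) * maximalFn n Ω u t) (𝓝[>] 0) (𝓝 0)

/-- `Λ_n^0(Ω)`: equals `L_{exp,0}(Ω)` if n = 2 and `L₀^{n/(n-2),∞}(Ω)` if n ≥ 3. -/
def MemLambda0 (n : ℕ) (Ω : Set (Euc n)) (u : Euc n → ℝ) : Prop :=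
  if n = 2 then MemLexp0 n Ω u else MemWeakL0 n Ω u

lemma decRearr_set_nonempty {n : ℕ} {Ω : Set (Euc n)} (hΩ : MeasurableSet Ω)
    (hfin : volume Ω ≠ ∞) {u : Euc n → ℝ} (hu : AEMeasurable u (volume.restrict Ω))
    {t : ℝ} (ht : 0 < t) :
    {s : ℝ | 0 ≤ s ∧ volume {x ∈ Ω | s < |u x|} ≤ ENNReal.ofReal t}.Nonempty := by
  have : IsFiniteMeasure (volume.restrict Ω) := ⟨by simpa using hfin.lt_top⟩
  have h := tendsto_measure_iInter_atTop (μ := volume.restrict Ω)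
    (s := fun k : ℕ => {x | (k : ℝ) < |u x|})
    (fun k => nullMeasurableSet_lt aemeasurable_const hu.abs)
    (fun i j hij x (hx : (j : ℝ) < |u x|) => (Nat.cast_le.2 hij).trans_lt hx) ⟨0, measure_ne_top _ _⟩
  have he : (⋂ k : ℕ, {x | (k : ℝ) < |u x|}) = ∅ := by
    ext x
    obtain ⟨k, hk⟩ := exists_nat_ge |u x|
    simp only [Set.mem_iInter, Set.mem_ofPred_eq, Set.mem_empty_iff_false, iff_false, not_forall,
      not_lt]
    exact ⟨k, hk⟩
  rw [he, measure_empty] at h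
  obtain ⟨k, hk⟩ := (h.eventually (ge_mem_nhds (ENNReal.ofReal_pos.2 ht))).exists
  refine ⟨k, Nat.cast_nonneg k, ?_⟩
  rw [Function.comp_apply, Measure.restrict_apply' hΩ] at hk
  rwa [Set.inter_comm] at hk

lemma decRearr_nonneg {n : ℕ} (Ω : Set (Euc n)) (u : Euc n → ℝ) (t : ℝ) :
    0 ≤ decRearr n Ω u t :=
  Real.sInf_nonneg fun _ hs => hs.1

lemma decRearr_antitoneOn {n : ℕ} {Ω : Set (Euc n)} (hΩ : MeasurableSet Ω)
    (hfin : volume Ω ≠ ∞) {u : Euc n → ℝ} (hu : AEMeasurable u (volume.restrict Ω)) :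
    AntitoneOn (decRearr n Ω u) (Set.Ioi 0) := fun _ ht _ _ hts =>
  csInf_le_csInf ⟨0, fun _ hs => hs.1⟩ (decRearr_set_nonempty hΩ hfin hu ht)
    fun _ hs => ⟨hs.1, hs.2.trans (ENNReal.ofReal_le_ofReal hts)⟩

lemma decRearr_le_maximalFn {n : ℕ} {Ω : Set (Euc n)} {u : Euc n → ℝ}
    (hanti : AntitoneOn (decRearr n Ω u) (Set.Ioi 0)) {t : ℝ} (ht : 0 < t)
    (hint : IntervalIntegrable (decRearr n Ω u) volume 0 t) :
    decRearr n Ω u t ≤ maximalFn n Ω u t := by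
  have h : ∫ _ in (0 : ℝ)..t, decRearr n Ω u t ≤ ∫ s in (0 : ℝ)..t, decRearr n Ω u s := by
    apply intervalIntegral.integral_mono_on_of_le_Ioo ht.le intervalIntegrable_const hint
    intro s hs
    exact hanti hs.1 ht hs.2.le
  rw [intervalIntegral.integral_const, sub_zero, smul_eq_mul] at h
  rw [maximalFn, one_div, ← div_eq_inv_mul, le_div_iff₀ ht, mul_comm]
  exact h

lemma decRearr_intervalIntegrable {n : ℕ} {Ω : Set (Euc n)} {u : Euc n → ℝ}
    (hanti : AntitoneOn (decRearr n Ω u) (Set.Ioi 0)) {t : ℝ} (ht : 0 < t) {h : ℝ → ℝ}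
    (hh : IntervalIntegrable h volume 0 t)
    (hle : ∀ s, 0 < s → s ≤ t → decRearr n Ω u s ≤ h s) :
    IntervalIntegrable (decRearr n Ω u) volume 0 t := by
  rw [intervalIntegrable_iff_integrableOn_Ioc_of_le ht.le] at hh ⊢
  refine Integrable.mono' hh ?_ ?_
  · exact (aemeasurable_restrict_of_antitoneOn measurableSet_Ioc
      (hanti.mono fun _ hx => hx.1)).aestronglyMeasurable
  · refine (ae_restrict_iff' measurableSet_Ioc).2 (Eventually.of_forall fun s hs => ?_)
    rw [Real.norm_of_nonneg (decRearr_nonneg Ω u s)]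
    exact hle s hs.1 hs.2

/-- An absolutely convergent series in `L¹` converges in `L¹` to its pointwise sum. -/
lemma tendsto_integral_abs_sum_sub_tsum {α : Type*} [MeasurableSpace α] {μ : Measure α}
    {f : ℕ → α → ℝ} (hf : ∀ i, Integrable (f i) μ) (hs : Summable fun i => ∫ x, |f i x| ∂μ) :
    Integrable (fun x => ∑' i, f i x) μ ∧
      Tendsto (fun k => ∫ x, |∑ i ∈ Finset.range k, f i x - ∑' i, f i x| ∂μ) atTop (𝓝 0) := by
  have hfin : ∑' i, ∫⁻ x, ‖f i x‖ₑ ∂μ ≠ ∞ := by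
    have : ∀ i, ∫⁻ x, ‖f i x‖ₑ ∂μ = ENNReal.ofReal (∫ x, |f i x| ∂μ) := fun i =>
      (ofReal_integral_norm_eq_lintegral_enorm (hf i)).symm
    simp_rw [this]
    exact hs.tsum_ofReal_ne_top
  have hlint : ∀ k, ∫⁻ x, ∑' i, ‖f (i + k) x‖ₑ ∂μ = ∑' i, ∫⁻ x, ‖f (i + k) x‖ₑ ∂μ := fun k =>
    lintegral_tsum fun i => (hf (i + k)).1.enorm
  have hsum : ∀ᵐ x ∂μ, Summable fun i => f i x := by
    have h0 := hlint 0
    simp only [add_zero] at h0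
    filter_upwards [ae_lt_top' (AEMeasurable.tsum fun i => (hf i).1.enorm)
      (h0.trans_ne hfin)] with x hx
    have : Summable fun i => ‖f i x‖₊ := ENNReal.tsum_coe_ne_top_iff_summable.1 hx.ne
    exact Summable.of_nnnorm this
  have hle : ∀ k, ∫⁻ x, ‖∑ i ∈ Finset.range k, f i x - ∑' i, f i x‖ₑ ∂μ
      ≤ ∑' i, ∫⁻ x, ‖f (i + k) x‖ₑ ∂μ := fun k => by
    rw [← hlint k]
    refine lintegral_mono_ae ?_
    filter_upwards [hsum] with x hx
    rw [← hx.sum_add_tsum_nat_add k, sub_add_cancel_left, enorm_neg]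
    exact enorm_tsum_le_tsum_enorm
  have hmeas : AEStronglyMeasurable (fun x => ∑' i, f i x) μ := by
    refine aestronglyMeasurable_of_tendsto_ae atTop
      (f := fun k x => ∑ i ∈ Finset.range k, f i x) (fun k => ?_) ?_
    · exact (integrable_finsetSum _ fun i _ => hf i).1
    · filter_upwards [hsum] with x hx using hx.hasSum.tendsto_sum_nat
  have hF : Integrable (fun x => ∑' i, f i x) μ := by
    refine ⟨hmeas, ?_⟩
    have := hle 0
    simp only [Finset.range_zero, Finset.sum_empty, zero_sub, enorm_neg, add_zero] at this
    exact this.trans_lt hfin.lt_top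
  refine ⟨hF, ?_⟩
  have htail := ENNReal.tendsto_sum_nat_add _ hfin
  have := tendsto_of_tendsto_of_tendsto_of_le_of_le tendsto_const_nhds htail
    (fun _ => zero_le) hle
  have h2 := (ENNReal.tendsto_toReal ENNReal.zero_ne_top).comp this
  refine h2.congr fun k => ?_
  exact (integral_norm_eq_lintegral_enorm
    ((integrable_finsetSum _ fun i _ => hf i).sub hF).1).symm

/-- The Laplacian of a smooth function of the squared distance to a point. -/
lemma lapl_comp_norm_sub_sq {n : ℕ} {F f f' : ℝ → ℝ} (hF : ∀ s, HasDerivAt F (f s) s)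
    (hf : ∀ s, HasDerivAt f (f' s) s) (x₀ x : Euc n) :
    lapl n (fun y => F (‖y - x₀‖ ^ 2)) x =
      4 * ‖x - x₀‖ ^ 2 * f' (‖x - x₀‖ ^ 2) + 2 * n * f (‖x - x₀‖ ^ 2) := by
  have hsq : ∀ y : Euc n, HasFDerivAt (fun y : Euc n => ‖y - x₀‖ ^ 2)
      (2 • innerSL ℝ (y - x₀)) y := fun y => by
    simpa using ((hasFDerivAt_id y).sub_const x₀).norm_sq
  have h1 : fderiv ℝ (fun y => F (‖y - x₀‖ ^ 2)) =
      fun y => f (‖y - x₀‖ ^ 2) • (2 • innerSL ℝ (y - x₀)) := by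
    funext y
    exact ((hF _).comp_hasFDerivAt y (hsq y)).fderiv
  have hin : HasFDerivAt (fun y : Euc n => 2 • innerSL ℝ (y - x₀)) (2 • innerSL ℝ) x :=
    (((innerSL ℝ).hasFDerivAt (x := x - x₀)).comp x
      ((hasFDerivAt_id x).sub_const x₀)).const_smul 2
  have h2 := (((hf _).comp_hasFDerivAt x (hsq x)).smul hin).fderiv
  have h3 : ∀ i : Fin n, iteratedFDeriv ℝ 2 (fun y => F (‖y - x₀‖ ^ 2)) x
      ![EuclideanSpace.single i (1 : ℝ), EuclideanSpace.single i (1 : ℝ)] =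
      f (‖x - x₀‖ ^ 2) * 2 + f' (‖x - x₀‖ ^ 2) * 4 * ((x - x₀) i) ^ 2 := fun i => by
    rw [iteratedFDeriv_two_apply, h1]
    change fderiv ℝ ((f ∘ fun y => ‖y - x₀‖ ^ 2) • fun y => 2 • innerSL ℝ (y - x₀)) x _ _ = _
    rw [h2]
    simp [innerSL_apply_apply ℝ, EuclideanSpace.inner_single_right]
    ring
  rw [lapl, Finset.sum_congr rfl fun i _ => h3 i, Finset.sum_add_distrib,
    ← Finset.mul_sum _ _ (f' _ * 4), ← EuclideanSpace.real_norm_sq_eq]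
  simp
  ring

/-- Smooth cutoff, equal to `1` on `(-∞, b]` and to `0` on `[2b, ∞)`. -/
def radialCutoff (b s : ℝ) : ℝ := Real.smoothTransition (2 - s / b)

lemma radialCutoff_contDiff (b : ℝ) {m : ℕ∞} : ContDiff ℝ m (radialCutoff b) :=
  Real.smoothTransition.contDiff.comp (contDiff_const.sub (contDiff_id.div_const b))

lemma radialCutoff_nonneg (b s : ℝ) : 0 ≤ radialCutoff b s := Real.smoothTransition.nonneg _

lemma radialCutoff_le_one (b s : ℝ) : radialCutoff b s ≤ 1 := Real.smoothTransition.le_one _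

lemma radialCutoff_of_le {b s : ℝ} (hb : 0 < b) (h : s ≤ b) : radialCutoff b s = 1 := by
  apply Real.smoothTransition.one_of_one_le
  have : s / b ≤ 1 := (div_le_one hb).2 h
  linarith

lemma radialCutoff_of_ge {b s : ℝ} (hb : 0 < b) (h : 2 * b ≤ s) : radialCutoff b s = 0 := by
  apply Real.smoothTransition.zero_of_nonpos
  have : 2 ≤ s / b := (le_div_iff₀ hb).2 h
  linarith

/-- Minus the derivative, in the variable `σ = ‖x‖²`, of a smoothly truncated and regularized
Green function (up to a multiplicative constant). -/
def greenDensity (n : ℕ) (b δ σ : ℝ) : ℝ :=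
  radialCutoff b σ * (σ ^ 2 + δ ^ 4) ^ (-((n : ℝ) / 4))

/-- The derivative of `greenDensity`. -/
def greenDensityDeriv (n : ℕ) (b δ σ : ℝ) : ℝ :=
  deriv (radialCutoff b) σ * (σ ^ 2 + δ ^ 4) ^ (-((n : ℝ) / 4)) +
    radialCutoff b σ * (2 * σ * -((n : ℝ) / 4) * (σ ^ 2 + δ ^ 4) ^ (-((n : ℝ) / 4) - 1))

/-- A smoothly truncated and regularized Green function (up to a multiplicative constant), as a
function of `s = ‖x‖²`. -/
def greenProfile (n : ℕ) (b δ s : ℝ) : ℝ := ∫ σ in s..(2 * b), greenDensity n b δ σ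

section

variable {n : ℕ} {b δ : ℝ}

lemma greenDensity_contDiff (hδ : 0 < δ) : ContDiff ℝ (⊤ : ℕ∞) (greenDensity n b δ) := by
  refine (radialCutoff_contDiff b).mul (ContDiff.rpow_const_of_ne ?_ fun s => ?_)
  · fun_prop
  · positivity

lemma greenDensity_nonneg (hδ : 0 < δ) (σ : ℝ) : 0 ≤ greenDensity n b δ σ :=
  mul_nonneg (radialCutoff_nonneg b σ) (by positivity)

lemma greenDensity_of_ge (hb : 0 < b) {σ : ℝ} (h : 2 * b ≤ σ) : greenDensity n b δ σ = 0 := by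
  rw [greenDensity, radialCutoff_of_ge hb h, zero_mul]

lemma greenDensity_hasDerivAt (hδ : 0 < δ) (σ : ℝ) :
    HasDerivAt (greenDensity n b δ) (greenDensityDeriv n b δ σ) σ := by
  have h1 : HasDerivAt (radialCutoff b) (deriv (radialCutoff b) σ) σ :=
    ((radialCutoff_contDiff b (m := 1)).differentiable one_ne_zero σ).hasDerivAt
  have h2 : HasDerivAt (fun σ : ℝ => σ ^ 2 + δ ^ 4) (2 * σ) σ := by
    simpa using (hasDerivAt_pow 2 σ).add_const (δ ^ 4)
  exact h1.mul (h2.rpow_const (Or.inl (by positivity)))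

lemma sq_rpow_neg_div_four {σ : ℝ} (hσ : 0 < σ) :
    (σ ^ 2) ^ (-((n : ℝ) / 4)) = σ ^ (-((n : ℝ) / 2)) := by
  rw [← Real.rpow_natCast σ 2, ← Real.rpow_mul hσ.le]
  congr 1
  push_cast
  ring

lemma greenDensity_le (hδ : 0 < δ) {σ : ℝ} (hσ : 0 < σ) :
    greenDensity n b δ σ ≤ σ ^ (-((n : ℝ) / 2)) := by
  rw [← sq_rpow_neg_div_four hσ, greenDensity, ← one_mul ((σ ^ 2) ^ _)]
  refine mul_le_mul (radialCutoff_le_one b σ) ?_ (by positivity) zero_le_one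
  refine Real.rpow_le_rpow_of_nonpos (by positivity) ?_ (neg_nonpos.2 (by positivity))
  exact le_add_of_nonneg_right (by positivity)

lemma le_greenDensity (hb : 0 < b) (hδ : 0 < δ) {σ : ℝ} (hσ : δ ^ 2 ≤ σ) (hσb : σ ≤ b) :
    2 ^ (-((n : ℝ) / 4)) * σ ^ (-((n : ℝ) / 2)) ≤ greenDensity n b δ σ := by
  have hσ0 : 0 < σ := (by positivity : 0 < δ ^ 2).trans_le hσ
  rw [← sq_rpow_neg_div_four hσ0, greenDensity, radialCutoff_of_le hb hσb, one_mul,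
    ← Real.mul_rpow zero_le_two (by positivity)]
  refine Real.rpow_le_rpow_of_nonpos (by positivity) ?_ (neg_nonpos.2 (by positivity))
  nlinarith [pow_le_pow_left₀ (by positivity) hσ 2]

lemma greenDensity_intervalIntegrable (hδ : 0 < δ) (s t : ℝ) :
    IntervalIntegrable (greenDensity n b δ) volume s t :=
  (greenDensity_contDiff hδ).continuous.intervalIntegrable s t

lemma greenProfile_hasDerivAt (hδ : 0 < δ) (s : ℝ) :
    HasDerivAt (greenProfile n b δ) (-greenDensity n b δ s) s := by
  have hc := (greenDensity_contDiff (n := n) (b := b) hδ).continuous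
  exact intervalIntegral.integral_hasDerivAt_left (hc.intervalIntegrable _ _)
    (hc.stronglyMeasurableAtFilter _ _) hc.continuousAt

lemma greenProfile_contDiff (hδ : 0 < δ) : ContDiff ℝ (⊤ : ℕ∞) (greenProfile n b δ) := by
  rw [contDiff_infty_iff_deriv]
  refine ⟨fun s => (greenProfile_hasDerivAt hδ s).differentiableAt, ?_⟩
  rw [show deriv (greenProfile n b δ) = fun s => -greenDensity n b δ s from
    funext fun s => (greenProfile_hasDerivAt hδ s).deriv]
  exact (greenDensity_contDiff hδ).neg

lemma greenProfile_antitone (hδ : 0 < δ) : Antitone (greenProfile n b δ) :=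
  antitone_of_hasDerivAt_nonpos (greenProfile_hasDerivAt hδ)
    fun s => neg_nonpos.2 (greenDensity_nonneg hδ s)

lemma greenProfile_of_ge (hb : 0 < b) {s : ℝ} (h : 2 * b ≤ s) : greenProfile n b δ s = 0 := by
  rw [greenProfile, intervalIntegral.integral_congr (g := fun _ => (0 : ℝ)),
    intervalIntegral.integral_zero]
  intro σ hσ
  rw [Set.uIcc_of_ge h] at hσ
  exact greenDensity_of_ge hb hσ.1

lemma greenProfile_nonneg (hb : 0 < b) (hδ : 0 < δ) (s : ℝ) : 0 ≤ greenProfile n b δ s := by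
  rcases le_total s (2 * b) with h | h
  · exact intervalIntegral.integral_nonneg h fun σ _ => greenDensity_nonneg hδ σ
  · exact (greenProfile_of_ge hb h).ge

lemma greenProfile_le (hn : 1 ≤ n) (hb : 0 < b) (hδ : 0 < δ) {s : ℝ} (hs : 0 < s) :
    greenProfile n b δ s ≤ (∫ σ in (0 : ℝ)..(2 * b), σ ^ (-(1 / 2) : ℝ)) *
      s ^ (-(((n : ℝ) - 1) / 2)) := by
  have hint : ∀ x y : ℝ, IntervalIntegrable (fun σ : ℝ => σ ^ (-(1 / 2) : ℝ)) volume x y :=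
    fun x y => intervalIntegral.intervalIntegrable_rpow' (by norm_num)
  have hn' : (0 : ℝ) ≤ ((n : ℝ) - 1) / 2 := by
    have : (1 : ℝ) ≤ n := by exact_mod_cast hn
    linarith
  rcases le_total s (2 * b) with h | h
  · have h1 : greenProfile n b δ s ≤
        ∫ σ in s..(2 * b), σ ^ (-(1 / 2) : ℝ) * s ^ (-(((n : ℝ) - 1) / 2)) := by
      apply intervalIntegral.integral_mono_on h (greenDensity_intervalIntegrable hδ _ _)
        ((hint _ _).mul_const _)
      intro σ hσ
      have hσ0 : 0 < σ := hs.trans_le hσ.1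
      refine (greenDensity_le hδ hσ0).trans ?_
      rw [show -((n : ℝ) / 2) = -(1 / 2) + -(((n : ℝ) - 1) / 2) by ring, Real.rpow_add hσ0]
      exact mul_le_mul_of_nonneg_left
        (Real.rpow_le_rpow_of_nonpos hs hσ.1 (neg_nonpos.2 hn')) (by positivity)
    rw [intervalIntegral.integral_mul_const] at h1
    refine h1.trans (mul_le_mul_of_nonneg_right ?_ (by positivity))
    rw [← intervalIntegral.integral_add_adjacent_intervals (hint 0 s) (hint s (2 * b))]
    refine le_add_of_nonneg_left (intervalIntegral.integral_nonneg hs.le fun σ hσ => ?_)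
    exact Real.rpow_nonneg hσ.1 _
  · rw [greenProfile_of_ge hb h]
    refine mul_nonneg (intervalIntegral.integral_nonneg (by positivity) fun σ hσ => ?_)
      (by positivity)
    exact Real.rpow_nonneg hσ.1 _

lemma le_greenProfile (hb : 0 < b) (hδ : 0 < δ) {s : ℝ} (hs : δ ^ 2 ≤ s) (hsb : s ≤ b) :
    2 ^ (-((n : ℝ) / 4)) * (∫ σ in s..b, σ ^ (-((n : ℝ) / 2))) ≤ greenProfile n b δ s := by
  have hs0 : 0 < s := (by positivity : 0 < δ ^ 2).trans_le hs
  rw [greenProfile, ← intervalIntegral.integral_const_mul,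
    ← intervalIntegral.integral_add_adjacent_intervals (greenDensity_intervalIntegrable hδ s b)
      (greenDensity_intervalIntegrable hδ b (2 * b))]
  refine le_add_of_le_of_nonneg ?_ (intervalIntegral.integral_nonneg (by linarith)
    fun σ _ => greenDensity_nonneg hδ σ)
  refine intervalIntegral.integral_mono_on hsb ?_ (greenDensity_intervalIntegrable hδ _ _)
    fun σ hσ => le_greenDensity hb hδ (hs.trans hσ.1) hσ.2
  refine (intervalIntegral.intervalIntegrable_rpow (Or.inr ?_)).const_mul _
  rw [Set.uIcc_of_le hsb]
  exact fun h => absurd h.1 (not_le.2 hs0)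

/-- The Laplacian of `x ↦ greenProfile n b δ (‖x‖ ^ 2)` as a function of `s = ‖x‖ ^ 2`. -/
def greenLapl (n : ℕ) (b δ s : ℝ) : ℝ :=
  4 * s * (-greenDensityDeriv n b δ s) + 2 * n * (-greenDensity n b δ s)

lemma greenLapl_continuous (hδ : 0 < δ) : Continuous (greenLapl n b δ) := by
  have h1 := (greenDensity_contDiff (n := n) (b := b) hδ).continuous
  have h2 : Continuous (greenDensityDeriv n b δ) := by
    rw [← show deriv (greenDensity n b δ) = greenDensityDeriv n b δ from
      funext fun s => (greenDensity_hasDerivAt hδ s).deriv]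
    exact (greenDensity_contDiff hδ).continuous_deriv (by simp)
  unfold greenLapl
  fun_prop

lemma greenLapl_eq (hδ : 0 < δ) (s : ℝ) :
    greenLapl n b δ s =
      -(4 * s * (deriv (radialCutoff b) s * (s ^ 2 + δ ^ 4) ^ (-((n : ℝ) / 4)))) -
        2 * n * radialCutoff b s * (δ ^ 4 * (s ^ 2 + δ ^ 4) ^ (-((n : ℝ) / 4) - 1)) := by
  have h : (s ^ 2 + δ ^ 4) ^ (-((n : ℝ) / 4)) =
      (s ^ 2 + δ ^ 4) ^ (-((n : ℝ) / 4) - 1) * (s ^ 2 + δ ^ 4) := by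
    have : s ^ 2 + δ ^ 4 ≠ 0 := by positivity
    rw [Real.rpow_sub_one this, div_mul_cancel₀ _ this]
  rw [greenLapl, greenDensityDeriv, greenDensity, h]
  ring

lemma exists_bound_deriv_radialCutoff (n : ℕ) (hb : 0 < b) :
    ∃ C : ℝ, 0 ≤ C ∧ ∀ δ s : ℝ, 0 < δ → 0 ≤ s →
      |4 * s * (deriv (radialCutoff b) s * (s ^ 2 + δ ^ 4) ^ (-((n : ℝ) / 4)))| ≤ C := by
  have hcont : Continuous (deriv (radialCutoff b)) :=
    (radialCutoff_contDiff b (m := 1)).continuous_deriv le_rfl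
  obtain ⟨M, hM⟩ := isCompact_Icc.exists_bound_of_continuousOn (s := Set.Icc b (2 * b))
    hcont.continuousOn
  have hM0 : 0 ≤ M := (norm_nonneg _).trans (hM b ⟨le_rfl, by linarith⟩)
  refine ⟨4 * (2 * b) * (M * b ^ (-((n : ℝ) / 2))), by positivity, fun δ s hδ hs => ?_⟩
  have hzero : ∀ c : ℝ, (∀ᶠ x in 𝓝 s, radialCutoff b x = c) → deriv (radialCutoff b) s = 0 :=
    fun c hc => by
      rw [EventuallyEq.deriv_eq (f := fun _ => c) hc, deriv_const]
  rcases lt_or_ge s b with h | h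
  · rw [hzero 1 ((eventually_lt_nhds h).mono fun x hx => radialCutoff_of_le hb hx.le)]
    simp only [zero_mul, mul_zero, abs_zero]
    positivity
  rcases lt_or_ge (2 * b) s with h' | h'
  · rw [hzero 0 ((eventually_gt_nhds h').mono fun x hx => radialCutoff_of_ge hb hx.le)]
    simp only [zero_mul, mul_zero, abs_zero]
    positivity
  rw [abs_mul (4 * s), abs_mul (deriv _ _), abs_of_nonneg (by positivity : 0 ≤ 4 * s),
    abs_of_nonneg (by positivity : 0 ≤ (s ^ 2 + δ ^ 4) ^ (-((n : ℝ) / 4)))]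
  rw [← sq_rpow_neg_div_four hb]
  gcongr ?_ * (?_ * ?_)
  · linarith
  · exact hM s ⟨h, h'⟩
  · refine Real.rpow_le_rpow_of_nonpos (by positivity) ?_ (neg_nonpos.2 (by positivity))
    have := pow_le_pow_left₀ hb.le h 2
    have : 0 ≤ δ ^ 4 := by positivity
    linarith

lemma integrable_rpow_one_add_norm_pow_four (n : ℕ) :
    Integrable (fun y : Euc n => (1 + ‖y‖ ^ 4) ^ (-((n : ℝ) / 4) - 1)) := by
  have h := integrable_one_add_norm (E := Euc n) (μ := volume) (r := n + 4) (by simp)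
  refine (h.const_mul (8 ^ ((n : ℝ) / 4 + 1))).mono' ?_ (Eventually.of_forall fun y => ?_)
  · exact Measurable.aestronglyMeasurable (by fun_prop)
  have hy := norm_nonneg y
  rw [Real.norm_of_nonneg (by positivity)]
  have h1 : (1 + ‖y‖) ^ (-((n : ℝ) + 4)) = ((1 + ‖y‖) ^ 4) ^ (-((n : ℝ) / 4) - 1) := by
    rw [← Real.rpow_natCast (1 + ‖y‖) 4, ← Real.rpow_mul (by positivity)]
    congr 1
    push_cast
    ring
  have h2 : (8 : ℝ) ^ ((n : ℝ) / 4 + 1) = (1 / 8) ^ (-((n : ℝ) / 4) - 1) := by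
    rw [one_div, Real.inv_rpow (by norm_num), ← Real.rpow_neg (by norm_num)]
    congr 1
    ring
  rw [h1, h2, ← Real.mul_rpow (by norm_num) (by positivity)]
  refine Real.rpow_le_rpow_of_nonpos (by positivity) ?_ ?_
  · nlinarith [sq_nonneg (‖y‖ - 1), sq_nonneg (‖y‖ ^ 2 - 1), sq_nonneg (‖y‖ ^ 2 - ‖y‖)]
  · have : 0 ≤ (n : ℝ) / 4 := by positivity
    linarith

lemma pow_four_mul_rpow_eq (n : ℕ) (hδ : 0 < δ) (y : Euc n) :
    δ ^ 4 * ((‖y‖ ^ 2) ^ 2 + δ ^ 4) ^ (-((n : ℝ) / 4) - 1) =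
      (δ ^ n)⁻¹ * (1 + ‖δ⁻¹ • y‖ ^ 4) ^ (-((n : ℝ) / 4) - 1) := by
  have h1 : (‖y‖ ^ 2) ^ 2 + δ ^ 4 = δ ^ 4 * (1 + ‖δ⁻¹ • y‖ ^ 4) := by
    rw [norm_smul, norm_inv, Real.norm_of_nonneg hδ.le]
    field_simp
    ring
  have h2 : δ ^ 4 * (δ ^ 4) ^ (-((n : ℝ) / 4) - 1) = (δ ^ n)⁻¹ := by
    rw [← Real.rpow_natCast δ 4, ← Real.rpow_mul hδ.le, ← Real.rpow_add hδ,
      ← Real.rpow_natCast δ n, ← Real.rpow_neg hδ.le]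
    congr 1
    push_cast
    ring
  rw [h1, Real.mul_rpow (by positivity) (by positivity), ← mul_assoc, h2]

/-- The regularized Green functions have Laplacians bounded in `L¹`. -/
lemma exists_integral_abs_greenLapl_le (n : ℕ) (hb : 0 < b) {Ω : Set (Euc n)}
    (hfin : volume Ω ≠ ∞) (x₀ : Euc n) :
    ∃ K : ℝ, ∀ δ : ℝ, 0 < δ → IntegrableOn (fun x => greenLapl n b δ (‖x - x₀‖ ^ 2)) Ω ∧
      ∫ x in Ω, |greenLapl n b δ (‖x - x₀‖ ^ 2)| ≤ K := by
  obtain ⟨C, hC0, hC⟩ := exists_bound_deriv_radialCutoff n hb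
  set J : ℝ := ∫ y : Euc n, (1 + ‖y‖ ^ 4) ^ (-((n : ℝ) / 4) - 1) with hJ
  refine ⟨(∫ _ in Ω, C) + 2 * n * J, fun δ hδ => ?_⟩
  set q : Euc n → ℝ := fun y => (1 + ‖δ⁻¹ • y‖ ^ 4) ^ (-((n : ℝ) / 4) - 1)
  have hq : Integrable q :=
    (integrable_rpow_one_add_norm_pow_four n).comp_smul (inv_ne_zero hδ.ne')
  have hqint : ∫ y, q y = δ ^ n * J := by
    have := Measure.integral_comp_inv_smul_of_nonneg (volume : Measure (Euc n))
      (fun y : Euc n => (1 + ‖y‖ ^ 4) ^ (-((n : ℝ) / 4) - 1)) hδ.le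
    simpa using this
  have hbound : ∀ x : Euc n, |greenLapl n b δ (‖x - x₀‖ ^ 2)| ≤
      C + 2 * n * ((δ ^ n)⁻¹ * q (x - x₀)) := fun x => by
    rw [greenLapl_eq hδ, ← pow_four_mul_rpow_eq n hδ]
    refine (abs_sub _ _).trans (add_le_add ?_ ?_)
    · rw [abs_neg]
      exact hC δ _ hδ (by positivity)
    · have := radialCutoff_nonneg b (‖x - x₀‖ ^ 2)
      rw [abs_of_nonneg (by positivity)]
      refine mul_le_mul_of_nonneg_right ?_ (by positivity)
      exact mul_le_of_le_one_right (by positivity) (radialCutoff_le_one _ _)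
  have hq' : Integrable fun x => 2 * n * ((δ ^ n)⁻¹ * q (x - x₀)) :=
    ((hq.comp_sub_right x₀).const_mul _).const_mul _
  have hCint : IntegrableOn (fun _ : Euc n => C) Ω := integrableOn_const hfin
  have hsum : IntegrableOn (fun x => C + 2 * n * ((δ ^ n)⁻¹ * q (x - x₀))) Ω :=
    hCint.add hq'.integrableOn
  have hcont : Continuous fun x : Euc n => greenLapl n b δ (‖x - x₀‖ ^ 2) :=
    (greenLapl_continuous hδ).comp (by fun_prop)
  have hint : IntegrableOn (fun x => greenLapl n b δ (‖x - x₀‖ ^ 2)) Ω :=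
    Integrable.mono' hsum hcont.aestronglyMeasurable (Eventually.of_forall hbound)
  refine ⟨hint, (integral_mono hint.abs hsum hbound).trans ?_⟩
  rw [integral_add hCint hq'.integrableOn]
  gcongr
  refine (setIntegral_le_integral hq' (Eventually.of_forall fun x => by positivity)).trans ?_
  rw [integral_const_mul, integral_const_mul, integral_sub_right_eq_self q x₀, hqint,
    inv_mul_cancel_left₀ (by positivity)]

end

lemma volume_ball_sqrt {n : ℕ} (x₀ : Euc n) {s : ℝ} (hs : 0 < s) :
    volume (Metric.ball x₀ (√s)) =
      ENNReal.ofReal (volume.real (Metric.ball (0 : Euc n) 1) * s ^ ((n : ℝ) / 2)) := by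
  rw [Measure.addHaar_ball_of_pos _ _ (Real.sqrt_pos.2 hs), mul_comm (volume.real _),
    ENNReal.ofReal_mul (by positivity), ofReal_measureReal, finrank_euclideanSpace_fin]
  congr 2
  rw [Real.sqrt_eq_rpow, ← Real.rpow_mul_natCast hs.le]
  congr 1
  ring

lemma volume_real_unitBall_pos (n : ℕ) : 0 < volume.real (Metric.ball (0 : Euc n) 1) :=
  ENNReal.toReal_pos (Metric.measure_ball_pos _ _ one_pos).ne' measure_ball_lt_top.ne

lemma tendsto_const_mul_rpow_nhdsGT_zero {c r : ℝ} (hc : 0 < c) (hr : 0 < r) :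
    Tendsto (fun s : ℝ => c * s ^ r) (𝓝[>] 0) (𝓝[>] 0) := by
  refine tendsto_nhdsWithin_iff.2 ⟨?_, ?_⟩
  · have h : ContinuousAt (fun s : ℝ => c * s ^ r) 0 :=
      continuousAt_const.mul (Real.continuousAt_rpow_const _ _ (Or.inr hr.le))
    have := h.tendsto
    simp only [Real.zero_rpow hr.ne', mul_zero] at this
    exact this.mono_left nhdsWithin_le_nhds
  · filter_upwards [self_mem_nhdsWithin] with s hs
    exact mul_pos hc (Real.rpow_pos_of_pos hs r)

section

variable {n : ℕ} {Ω : Set (Euc n)} {u : Euc n → ℝ}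

lemma eventually_decRearr_le_maximalFn
    (hanti : AntitoneOn (decRearr n Ω u) (Set.Ioi 0)) {V : ℝ} (hV : 0 < V) {h : ℝ → ℝ}
    (hh : ∀ t, IntervalIntegrable h volume 0 t)
    (hle : ∀ s, 0 < s → s ≤ V → decRearr n Ω u s ≤ h s) :
    ∀ᶠ t in 𝓝[>] (0 : ℝ), decRearr n Ω u t ≤ maximalFn n Ω u t := by
  filter_upwards [Ioc_mem_nhdsGT hV] with t ht
  exact decRearr_le_maximalFn hanti ht.1
    (decRearr_intervalIntegrable hanti ht.1 (hh t) fun s hs hst => hle s hs (hst.trans ht.2))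

lemma MemLexp.eventually_decRearr_le (hanti : AntitoneOn (decRearr n Ω u) (Set.Ioi 0))
    (hV : 0 < (volume Ω).toReal) (hu : MemLexp n Ω u) :
    ∀ᶠ t in 𝓝[>] (0 : ℝ), decRearr n Ω u t ≤ maximalFn n Ω u t := by
  obtain ⟨M, hM⟩ := hu
  refine eventually_decRearr_le_maximalFn hanti hV
    (h := fun s => M * (1 + (Real.log (volume Ω).toReal - Real.log s))) (fun t => ?_) ?_
  · exact (intervalIntegrable_const.add (intervalIntegrable_const.sub
      intervalIntegral.intervalIntegrable_log')).const_mul M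
  · intro s hs hsV
    have h1 := hM s hs hsV
    have h2 : 0 ≤ Real.log ((volume Ω).toReal / s) := Real.log_nonneg ((one_le_div hs).2 hsV)
    rw [div_le_iff₀ (by linarith), Real.log_div hV.ne' hs.ne'] at h1
    exact h1

lemma MemWeakL.eventually_decRearr_le (hn : 2 ≤ n)
    (hanti : AntitoneOn (decRearr n Ω u) (Set.Ioi 0))
    (hV : 0 < (volume Ω).toReal) (hu : MemWeakL n Ω u) :
    ∀ᶠ t in 𝓝[>] (0 : ℝ), decRearr n Ω u t ≤ maximalFn n Ω u t := by
  obtain ⟨M, hM⟩ := hu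
  have hn' : (2 : ℝ) ≤ n := by exact_mod_cast hn
  refine eventually_decRearr_le_maximalFn hanti hV
    (h := fun s => M * s ^ (-(((n : ℝ) - 2) / n))) (fun t => ?_) ?_
  · refine (intervalIntegral.intervalIntegrable_rpow' ?_).const_mul M
    rw [neg_lt_neg_iff, div_lt_one (by linarith)]
    linarith
  · intro s hs hsV
    have h1 := hM s hs hsV
    rw [Real.rpow_neg hs.le, ← div_eq_mul_inv, le_div_iff₀ (by positivity), mul_comm]
    exact h1

/-- Functions in `Λ_n^0(Ω)` have a rearrangement that is negligible with respect to the profile of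
the Green function. -/
lemma MemLambda0.eventually_decRearr_le (hn : 2 ≤ n)
    (hanti : AntitoneOn (decRearr n Ω u) (Set.Ioi 0)) (hV : 0 < (volume Ω).toReal)
    (hu : MemLambda0 n Ω u) {w b c : ℝ} (hw : 0 < w) (hb : 0 < b) (hc : 0 < c) :
    ∀ᶠ s in 𝓝[>] (0 : ℝ), decRearr n Ω u (w * s ^ ((n : ℝ) / 2)) ≤
      c * ∫ σ in s..b, σ ^ (-((n : ℝ) / 2)) := by
  have hn0 : (0 : ℝ) < n := by exact_mod_cast (by lia : 0 < n)
  have htend := tendsto_const_mul_rpow_nhdsGT_zero hw (r := (n : ℝ) / 2) (by positivity)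
  rw [MemLambda0] at hu
  split_ifs at hu with h2
  · subst h2
    have hlim := hu.2.eventually (gt_mem_nhds (half_pos hc))
    have hlog : ∀ᶠ s in 𝓝[>] (0 : ℝ), Real.log s ≤ 2 * Real.log b + Real.log w :=
      Real.tendsto_log_nhdsGT_zero.eventually (eventually_le_atBot _)
    filter_upwards [htend.eventually hlim, htend.eventually (hu.1.eventually_decRearr_le hanti hV),
      htend.eventually (Ioo_mem_nhdsGT one_pos), hlog, Ioo_mem_nhdsGT hb] with s h1 h3 h4 h5 h6
    have hs : 0 < s := h6.1
    have hpos : 0 < Real.log (1 / (w * s ^ (((2 : ℕ) : ℝ) / 2))) :=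
      Real.log_pos ((one_lt_div h4.1).2 h4.2)
    rw [div_lt_iff₀ hpos] at h1
    have hint : ∫ σ in s..b, σ ^ (-(((2 : ℕ) : ℝ) / 2)) = Real.log b - Real.log s := by
      rw [← Real.log_div hb.ne' hs.ne', ← integral_inv_of_pos hs hb]
      refine intervalIntegral.integral_congr fun σ _ => ?_
      simp [Real.rpow_neg_one]
    have heq : Real.log (1 / (w * s ^ (((2 : ℕ) : ℝ) / 2))) = -Real.log w - Real.log s := by
      have : ((2 : ℕ) : ℝ) / 2 = 1 := by norm_num
      rw [this, Real.rpow_one, one_div, Real.log_inv, Real.log_mul hw.ne' hs.ne']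
      ring
    rw [hint]
    rw [heq] at h1
    nlinarith
  · set p : ℝ := ((n : ℝ) - 2) / n with hp
    set c' : ℝ := c * 2 ^ (-((n : ℝ) / 2)) * w ^ p with hc'
    have hlim := hu.2.eventually (gt_mem_nhds (by positivity : 0 < c'))
    filter_upwards [htend.eventually hlim,
      htend.eventually (hu.1.eventually_decRearr_le hn hanti hV), self_mem_nhdsWithin,
      Ioo_mem_nhdsGT (half_pos hb)] with s h1 h3 h4 h5
    have hs : 0 < s := h4
    have hpow : (w * s ^ ((n : ℝ) / 2)) ^ p = w ^ p * s ^ (((n : ℝ) - 2) / 2) := by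
      rw [Real.mul_rpow hw.le (by positivity), ← Real.rpow_mul hs.le]
      congr 2
      rw [hp]
      field_simp
    have hle : decRearr n Ω u (w * s ^ ((n : ℝ) / 2)) ≤
        c * (2 ^ (-((n : ℝ) / 2)) * s ^ (-(((n : ℝ) - 2) / 2))) := by
      rw [hpow] at h1
      have h6 : w ^ p * s ^ (((n : ℝ) - 2) / 2) * decRearr n Ω u (w * s ^ ((n : ℝ) / 2)) ≤ c' :=
        (mul_le_mul_of_nonneg_left h3 (by positivity)).trans h1.le
      rw [Real.rpow_neg hs.le, ← mul_assoc, ← div_eq_mul_inv, le_div_iff₀ (by positivity)]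
      refine le_of_mul_le_mul_left ?_ (by positivity : 0 < w ^ p)
      rw [hc'] at h6
      linarith
    refine hle.trans (mul_le_mul_of_nonneg_left ?_ hc.le)
    have hI : ∀ x y : ℝ, 0 < x → x ≤ y →
        IntervalIntegrable (fun σ : ℝ => σ ^ (-((n : ℝ) / 2))) volume x y := fun x y hx hxy => by
      refine intervalIntegral.intervalIntegrable_rpow (Or.inr ?_)
      rw [Set.uIcc_of_le hxy]
      exact fun h => absurd h.1 (not_le.2 hx)
    have h2s : s ≤ 2 * s := by linarith
    have hsb : 2 * s ≤ b := by linarith [h5.2]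
    rw [← intervalIntegral.integral_add_adjacent_intervals (hI s (2 * s) hs h2s)
      (hI (2 * s) b (by positivity) hsb)]
    refine le_add_of_le_of_nonneg ?_ (intervalIntegral.integral_nonneg hsb fun σ hσ =>
      Real.rpow_nonneg ((by positivity : 0 ≤ 2 * s).trans hσ.1) _)
    have hconst : ∫ _ in s..(2 * s), (2 * s) ^ (-((n : ℝ) / 2)) =
        2 ^ (-((n : ℝ) / 2)) * s ^ (-(((n : ℝ) - 2) / 2)) := by
      rw [intervalIntegral.integral_const, smul_eq_mul, Real.mul_rpow zero_le_two hs.le,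
        show -(((n : ℝ) - 2) / 2) = -((n : ℝ) / 2) + 1 by ring, Real.rpow_add_one hs.ne']
      ring
    rw [← hconst]
    refine intervalIntegral.integral_mono_on h2s intervalIntegrable_const (hI s (2 * s) hs h2s)
      fun σ hσ => ?_
    exact Real.rpow_le_rpow_of_nonpos (hs.trans_le hσ.1) hσ.2 (neg_nonpos.2 (by positivity))

end

lemma isTestFun_comp_norm_sub_sq {n : ℕ} {Ω : Set (Euc n)} {x₀ : Euc n} {b : ℝ}
    (hball : ∀ x, ‖x - x₀‖ ^ 2 ≤ 2 * b → x ∈ Ω) {F : ℝ → ℝ} (hF : ContDiff ℝ (⊤ : ℕ∞) F)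
    (hzero : ∀ s, 2 * b ≤ s → F s = 0) : IsTestFun n Ω fun x => F (‖x - x₀‖ ^ 2) := by
  have hclosed : IsClosed {x : Euc n | ‖x - x₀‖ ^ 2 ≤ 2 * b} :=
    isClosed_le (by fun_prop) continuous_const
  have hsub : tsupport (fun x => F (‖x - x₀‖ ^ 2)) ⊆ {x : Euc n | ‖x - x₀‖ ^ 2 ≤ 2 * b} := by
    refine closure_minimal (fun x hx => ?_) hclosed
    by_contra h
    exact hx (hzero _ (not_le.1 h).le)
  have hbdd : Bornology.IsBounded {x : Euc n | ‖x - x₀‖ ^ 2 ≤ 2 * b} := by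
    refine (Metric.isBounded_closedBall (x := x₀) (r := √(2 * b))).subset fun x hx => ?_
    rw [Metric.mem_closedBall, dist_eq_norm]
    exact Real.le_sqrt_of_sq_le hx
  refine ⟨hF.comp ((contDiff_id.sub contDiff_const).norm_sq ℝ), ?_, hsub.trans hball⟩
  exact (Metric.isCompact_of_isClosed_isBounded hclosed hbdd).of_isClosed_subset
    (isClosed_tsupport _) hsub

/-- The regularized Green functions are dominated by a single integrable function. -/
lemma integrable_greenProfile_bound {n : ℕ} (hn : 1 ≤ n) (b A : ℝ) (x₀ : Euc n) :
    Integrable fun x : Euc n =>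
      (Set.Iio (√(2 * b))).indicator (fun y => A * (y ^ 2) ^ (-(((n : ℝ) - 1) / 2))) ‖x - x₀‖ := by
  have : Nonempty (Fin n) := ⟨⟨0, hn⟩⟩
  refine Integrable.comp_sub_right (f := fun x : Euc n => (Set.Iio (√(2 * b))).indicator
    (fun y => A * (y ^ 2) ^ (-(((n : ℝ) - 1) / 2))) ‖x‖) ?_ x₀
  rw [integrable_fun_norm_addHaar]
  have hconst : IntegrableOn (fun _ => A) (Set.Ioo 0 (√(2 * b))) :=
    integrableOn_const measure_Ioo_lt_top.ne
  rw [← integrable_indicator_iff measurableSet_Ioi]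
  refine (hconst.integrable_indicator measurableSet_Ioo).congr
    (Eventually.of_forall fun y => ?_)
  simp only [Set.indicator_apply, Set.mem_Ioi, Set.mem_Iio, Set.mem_Ioo,
    finrank_euclideanSpace_fin, smul_eq_mul]
  by_cases hy : 0 < y
  · by_cases hy' : y < √(2 * b)
    · simp only [hy, hy', and_self, if_true]
      rw [← Real.rpow_natCast y 2, ← Real.rpow_mul hy.le, ← Real.rpow_natCast y (n - 1),
        mul_left_comm, ← Real.rpow_add hy, Nat.cast_sub hn]
      norm_num
      ring_nf
      simp
    · simp only [hy, hy', and_false, if_false, if_true, mul_zero]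
  · simp [hy]

/-- The superposition of regularized Green functions used as a majorant. -/
def greenSum (n : ℕ) (b : ℝ) (δ : ℕ → ℝ) (x₀ x : Euc n) : ℝ :=
  ∑' i, (1 / 2) ^ i * greenProfile n b (δ i) (‖x - x₀‖ ^ 2)

section

variable {n : ℕ} {b : ℝ} {δ : ℕ → ℝ}

lemma summable_greenSum (hn : 1 ≤ n) (hb : 0 < b) (hδ : ∀ i, 0 < δ i) {s : ℝ} (hs : 0 < s) :
    Summable fun i => (1 / 2) ^ i * greenProfile n b (δ i) s := by
  refine Summable.of_nonneg_of_le
    (fun i => mul_nonneg (by positivity) (greenProfile_nonneg hb (hδ i) _))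
    (fun i => mul_le_mul_of_nonneg_left (greenProfile_le hn hb (hδ i) hs) (by positivity))
    (summable_geometric_two.mul_right _)

lemma le_greenSum (hn : 1 ≤ n) (hb : 0 < b) (hδ : ∀ i, 0 < δ i) {x₀ x : Euc n} (hx : x ≠ x₀)
    (k : ℕ) : (1 / 2) ^ k * greenProfile n b (δ k) (‖x - x₀‖ ^ 2) ≤ greenSum n b δ x₀ x :=
  (summable_greenSum hn hb hδ (pow_pos (norm_pos_iff.2 (sub_ne_zero.2 hx)) 2)).le_tsum k
    fun i _ => mul_nonneg (by positivity) (greenProfile_nonneg hb (hδ i) _)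

lemma memW21Delta0_greenSum (hn : 1 ≤ n) (hb : 0 < b) (hδ : ∀ i, 0 < δ i) {Ω : Set (Euc n)}
    (hfin : volume Ω ≠ ∞) {x₀ : Euc n} (hball : ∀ x, ‖x - x₀‖ ^ 2 ≤ 2 * b → x ∈ Ω) :
    MemW21Delta0 n Ω (greenSum n b δ x₀)
      fun x => ∑' i, (1 / 2) ^ i * greenLapl n b (δ i) (‖x - x₀‖ ^ 2) := by
  have : Nonempty (Fin n) := ⟨⟨0, hn⟩⟩
  have hsum : ∀ {f : ℕ → Euc n → ℝ} {K : ℝ}, (∀ i, ∫ x in Ω, |f i x| ≤ K) →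
      Summable fun i => ∫ x in Ω, |(1 / 2) ^ i * f i x| := fun {f K} h => by
    refine Summable.of_nonneg_of_le (fun i => integral_nonneg fun x => abs_nonneg _) (fun i => ?_)
      (summable_geometric_two.mul_right K)
    simp only [abs_mul, abs_of_nonneg (by positivity : (0 : ℝ) ≤ (1 / 2) ^ i)]
    rw [integral_const_mul]
    exact mul_le_mul_of_nonneg_left (h i) (by positivity)
  set A := ∫ σ in (0 : ℝ)..(2 * b), σ ^ (-(1 / 2) : ℝ)
  have hD := (integrable_greenProfile_bound hn b A x₀).integrableOn (s := Ω)
  have hprof : ∀ i, ∀ᵐ x ∂(volume.restrict Ω), |greenProfile n b (δ i) (‖x - x₀‖ ^ 2)| ≤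
      (Set.Iio (√(2 * b))).indicator (fun y => A * (y ^ 2) ^ (-(((n : ℝ) - 1) / 2))) ‖x - x₀‖ :=
    fun i => by
    refine ae_restrict_of_ae ?_
    filter_upwards [Measure.ae_ne volume x₀] with x hx
    rw [abs_of_nonneg (greenProfile_nonneg hb (hδ i) _)]
    by_cases h : ‖x - x₀‖ < √(2 * b)
    · rw [Set.indicator_of_mem (by exact h)]
      exact greenProfile_le hn hb (hδ i) (pow_pos (norm_pos_iff.2 (sub_ne_zero.2 hx)) 2)
    · rw [Set.indicator_of_notMem (by exact h), greenProfile_of_ge hb]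
      exact (Real.sqrt_le_left (norm_nonneg _)).1 (not_lt.1 h)
  have hPint : ∀ i, IntegrableOn (fun x => greenProfile n b (δ i) (‖x - x₀‖ ^ 2)) Ω := fun i =>
    Integrable.mono' hD (((greenProfile_contDiff (hδ i)).continuous.comp
      (by fun_prop)).aestronglyMeasurable) (hprof i)
  have hP := tendsto_integral_abs_sum_sub_tsum (fun i => (hPint i).const_mul ((1 / 2) ^ i))
    (hsum fun i => integral_mono_ae (hPint i).abs hD (hprof i))
  obtain ⟨K, hK⟩ := exists_integral_abs_greenLapl_le n hb hfin x₀
  have hL := tendsto_integral_abs_sum_sub_tsum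
    (fun i => ((hK (δ i) (hδ i)).1.integrable).const_mul ((1 / 2) ^ i))
    (hsum fun i => (hK (δ i) (hδ i)).2)
  refine ⟨hP.1, hL.1, fun k x => ∑ i ∈ Finset.range k,
    (1 / 2) ^ i * greenProfile n b (δ i) (‖x - x₀‖ ^ 2), fun k => ?_, hP.2, hL.2.congr fun k => ?_⟩
  · refine isTestFun_comp_norm_sub_sq (b := b) hball (F := fun s => ∑ i ∈ Finset.range k,
      (1 / 2) ^ i * greenProfile n b (δ i) s) ?_ fun s hs => ?_
    · exact ContDiff.sum fun i _ => contDiff_const.mul (greenProfile_contDiff (hδ i))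
    · exact Finset.sum_eq_zero fun i _ => by rw [greenProfile_of_ge hb hs, mul_zero]
  · refine integral_congr_ae (Eventually.of_forall fun x => ?_)
    have := lapl_comp_norm_sub_sq (n := n)
      (F := fun s => ∑ i ∈ Finset.range k, (1 / 2) ^ i * greenProfile n b (δ i) s)
      (fun s => HasDerivAt.fun_sum fun i _ => (greenProfile_hasDerivAt (hδ i) s).const_mul _)
      (fun s => HasDerivAt.fun_sum fun i _ =>
        (greenDensity_hasDerivAt (hδ i) s).fun_neg.const_mul _) x₀ x
    simp only [this, greenLapl, Finset.mul_sum, ← Finset.sum_add_distrib]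
    congr 2
    refine Finset.sum_congr rfl fun i _ => ?_
    ring

lemma le_decRearr_greenSum (hn : 1 ≤ n) (hb : 0 < b) (hδ : ∀ i, 0 < δ i) {Ω : Set (Euc n)}
    (hΩ : MeasurableSet Ω) (hfin : volume Ω ≠ ∞) {x₀ : Euc n}
    (hball : ∀ x, ‖x - x₀‖ ^ 2 ≤ 2 * b → x ∈ Ω) {s : ℝ} (hs : 0 < s) (k : ℕ) :
    (1 / 2) ^ k * greenProfile n b (δ k) s ≤ decRearr n Ω (greenSum n b δ x₀)
      (volume.real (Metric.ball (0 : Euc n) 1) * s ^ ((n : ℝ) / 2)) := by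
  have : Nonempty (Fin n) := ⟨⟨0, hn⟩⟩
  have hw := volume_real_unitBall_pos n
  have hmeas := (memW21Delta0_greenSum hn hb hδ hfin hball).1.aestronglyMeasurable.aemeasurable
  refine le_csInf (decRearr_set_nonempty hΩ hfin hmeas (by positivity)) fun τ hτ => ?_
  by_contra! hlt
  have hcont : Continuous fun s => (1 / 2 : ℝ) ^ k * greenProfile n b (δ k) s :=
    continuous_const.mul (greenProfile_contDiff (hδ k)).continuous
  obtain ⟨r, hr, hrs⟩ := (((hcont.tendsto s).eventually (lt_mem_nhds hlt)).filter_mono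
    nhdsWithin_le_nhds |>.and (self_mem_nhdsWithin (s := Set.Ioi s))).exists
  have hr0 : 0 < r := hs.trans hrs
  have hsub : Metric.ball x₀ (√r) \ {x₀} ⊆ {x ∈ Ω | τ < |greenSum n b δ x₀ x|} := by
    rintro x ⟨hx, hx₀⟩
    rw [Metric.mem_ball, dist_eq_norm, Real.lt_sqrt (norm_nonneg _)] at hx
    have h1 : τ < (1 / 2) ^ k * greenProfile n b (δ k) (‖x - x₀‖ ^ 2) :=
      hr.trans_le (mul_le_mul_of_nonneg_left (greenProfile_antitone (hδ k) hx.le) (by positivity))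
    refine ⟨hball x (le_of_not_ge fun h => ?_), ?_⟩
    · rw [greenProfile_of_ge hb h, mul_zero] at h1
      exact absurd hτ.1 (not_le.2 h1)
    · exact (h1.trans_le (le_greenSum hn hb hδ hx₀ k)).trans_le (le_abs_self _)
  have hle := (measure_mono hsub).trans hτ.2
  rw [measure_sdiff_null (measure_singleton x₀), volume_ball_sqrt x₀ hr0,
    ENNReal.ofReal_le_ofReal_iff (by positivity)] at hle
  exact absurd (le_of_mul_le_mul_left hle hw) (not_le.2
    (Real.rpow_lt_rpow hs.le hrs (by positivity)))

end

/-- For Ω ⊆ ℝⁿ (n ≥ 2) open and bounded and u ∈ Λ_n^0(Ω), there exist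
v ∈ W^{2,1}_{Δ,0}(Ω) and a constant C ≥ 0 such that u*(t) ≤ v*(t) + C for 0 < t ≤ |Ω|. -/
theorem stmt_19 (n : ℕ) (hn : 2 ≤ n) (Ω : Set (Euc n)) (hΩo : IsOpen Ω)
    (hΩb : Bornology.IsBounded Ω) (u : Euc n → ℝ)
    (hmeas : AEMeasurable u (volume.restrict Ω)) (hu : MemLambda0 n Ω u) :
    ∃ v g : Euc n → ℝ, MemW21Delta0 n Ω v g ∧ ∃ C : ℝ, 0 ≤ C ∧
      ∀ t : ℝ, 0 < t → t ≤ (volume Ω).toReal →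
        decRearr n Ω u t ≤ decRearr n Ω v t + C := by
  have hfin : volume Ω ≠ ∞ := hΩb.measure_lt_top.ne
  rcases Ω.eq_empty_or_nonempty with rfl | ⟨x₀, hx₀⟩
  · refine ⟨0, 0, ⟨by simp, by simp, fun _ => 0, fun _ => ⟨contDiff_const, .zero, ?_⟩, by simp,
      by simp⟩, 0, le_rfl, fun t ht ht' => ?_⟩
    · simp [tsupport]
    · simp only [measure_empty, ENNReal.toReal_zero] at ht'
      linarith
  have hn1 : 1 ≤ n := by lia
  have hn0 : (0 : ℝ) < n := by exact_mod_cast hn1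
  have hV : 0 < (volume Ω).toReal := ENNReal.toReal_pos (hΩo.measure_pos _ ⟨x₀, hx₀⟩).ne' hfin
  have hanti := decRearr_antitoneOn hΩo.measurableSet hfin hmeas
  obtain ⟨ρ, hρ, hρΩ⟩ := Metric.nhds_basis_closedBall.mem_iff.1 (hΩo.mem_nhds hx₀)
  set b : ℝ := ρ ^ 2 / 2 with hbdef
  have hb : 0 < b := by positivity
  have hball : ∀ x, ‖x - x₀‖ ^ 2 ≤ 2 * b → x ∈ Ω := fun x hx => by
    apply hρΩ
    rw [Metric.mem_closedBall, dist_eq_norm]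
    exact (pow_le_pow_iff_left₀ (norm_nonneg _) hρ.le two_ne_zero).1 (by linarith)
  set w := volume.real (Metric.ball (0 : Euc n) 1)
  have hw : 0 < w := volume_real_unitBall_pos n
  have hex : ∀ k : ℕ, ∃ σ : ℝ, 0 < σ ∧ σ ≤ b ∧ σ ≤ 1 / ((k : ℝ) + 1) ∧ ∀ s, 0 < s → s < σ →
      decRearr n Ω u (w * s ^ ((n : ℝ) / 2)) ≤
        (2 ^ (-((n : ℝ) / 4)) * (1 / 2) ^ k) * ∫ σ in s..b, σ ^ (-((n : ℝ) / 2)) := fun k => by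
    have hev := hu.eventually_decRearr_le hn hanti hV hw hb
      (c := 2 ^ (-((n : ℝ) / 4)) * (1 / 2) ^ k) (by positivity)
    obtain ⟨σ, hσ, hσs⟩ := mem_nhdsGT_iff_exists_Ioo_subset.1 hev
    refine ⟨min σ (min b (1 / ((k : ℝ) + 1))), lt_min hσ (lt_min hb (by positivity)),
      (min_le_right _ _).trans (min_le_left _ _), (min_le_right _ _).trans (min_le_right _ _),
      fun s hs hs' => hσs ⟨hs, hs'.trans_le (min_le_left _ _)⟩⟩
  choose σ hσ0 hσb hσk hσ using hex
  have hδ : ∀ i, 0 < √(σ (i + 1)) := fun i => Real.sqrt_pos.2 (hσ0 _)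
  refine ⟨_, _, memW21Delta0_greenSum (δ := fun i => √(σ (i + 1))) hn1 hb hδ hfin hball,
    decRearr n Ω u (w * σ 0 ^ ((n : ℝ) / 2)), decRearr_nonneg _ _ _, fun t ht _ => ?_⟩
  have hσ0' := hσ0 0
  rcases le_or_gt (w * σ 0 ^ ((n : ℝ) / 2)) t with hle | hlt
  · exact (hanti (Set.mem_Ioi.2 (by positivity)) ht hle).trans
      (le_add_of_nonneg_left (decRearr_nonneg _ _ _))
  obtain ⟨s, hs, rfl⟩ : ∃ s : ℝ, 0 < s ∧ w * s ^ ((n : ℝ) / 2) = t := by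
    refine ⟨(t / w) ^ (2 / (n : ℝ)), by positivity, ?_⟩
    rw [← Real.rpow_mul (by positivity), div_mul_div_cancel₀ hn0.ne', div_self two_ne_zero,
      Real.rpow_one, mul_div_cancel₀ _ hw.ne']
  have hs0 : s < σ 0 := (Real.rpow_lt_rpow_iff hs.le hσ0'.le (by positivity)).1
    (lt_of_mul_lt_mul_left hlt hw.le)
  have hlim : ∃ k, σ k ≤ s := by
    obtain ⟨k, hk⟩ := exists_nat_one_div_lt hs
    exact ⟨k, (hσk k).trans hk.le⟩
  obtain ⟨k, hk⟩ : ∃ k, Nat.find hlim = k + 1 :=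
    Nat.exists_eq_succ_of_ne_zero fun h => absurd (h ▸ Nat.find_spec hlim) (not_le.2 hs0)
  have hk1 : σ (k + 1) ≤ s := hk ▸ Nat.find_spec hlim
  have hk2 : s < σ k := not_le.1 (Nat.find_min hlim (by lia))
  refine le_add_of_le_of_nonneg ((hσ k s hs hk2).trans ?_) (decRearr_nonneg _ _ _)
  refine le_trans ?_ (le_decRearr_greenSum hn1 hb hδ hΩo.measurableSet hfin hball hs k)
  rw [mul_comm ((2 : ℝ) ^ _), mul_assoc]
  refine mul_le_mul_of_nonneg_left (le_greenProfile hb (hδ k) ?_ (hk2.le.trans (hσb k)))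
    (by positivity)
  rwa [Real.sq_sqrt (hσ0 _).le]
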